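/- Let Γ be a primitive distance-regular graph with diameter D ≥ 3 that is Q-polynomial with respect to the ordering E_0, E_1, ..., E_D of its primitive idempotents, and fix a base vertex x. Write A* = A_1*. Then the four matrices AA*A_2 − A_2A*A, A*A_3 − A_3A*, A*A_2 − A_2A*, A*A − AA* are linearly dependent over ℂ; consequently det(B_1) = 0. -/

import Mathlib

open Matrix BigOperators

noncomputable section

structure DRG (X : Type) [Fintype X] [DecidableEq X] where
  G : SimpleGraph X
  D : ℕ
  hD : 3 ≤ D
  hconn : G.Connected
  hdiam_le : ∀ y z : X, G.dist y z ≤ D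
  hdiam : ∃ y z : X, G.dist y z = D
  p : ℕ → ℕ → ℕ → ℕ
  hp : ∀ h i j : ℕ, h ≤ D → i ≤ D → j ≤ D → ∀ y z : X, G.dist y z = h →
    Nat.card {w : X // G.dist y w = i ∧ G.dist z w = j} = p h i j

namespace DRG

variable {X : Type} [Fintype X] [DecidableEq X]

/-- The `i`-th distance matrix. -/
def A (Γ : DRG X) (i : ℕ) : Matrix X X ℂ :=
  Matrix.of fun y z => if Γ.G.dist y z = i then (1 : ℂ) else 0

/-- `c_i`, with the conventions `c_0 = 0` and `c_{D+1} = 1`. -/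
def cI (Γ : DRG X) (i : ℕ) : ℕ :=
  if i = 0 then 0 else if i ≤ Γ.D then Γ.p i 1 (i - 1) else 1

/-- `a_i`. -/
def aI (Γ : DRG X) (i : ℕ) : ℕ := Γ.p i 1 i

/-- `b_i`, with the convention `b_D = 0`. -/
def bI (Γ : DRG X) (i : ℕ) : ℕ := if i < Γ.D then Γ.p i 1 (i + 1) else 0

/-- `k_i`. -/
def kI (Γ : DRG X) (i : ℕ) : ℕ := Γ.p 0 i i

/-- The valency `k = b_0`. -/
def kval (Γ : DRG X) : ℕ := Γ.p 0 1 1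

/-- `Γ` is primitive: each distance-`i` graph is connected. -/
def Primitive (Γ : DRG X) : Prop :=
  ∀ i : ℕ, 1 ≤ i → i ≤ Γ.D →
    (SimpleGraph.fromRel fun y z => Γ.G.dist y z = i).Connected

/-- The Hermitean inner product `⟨R,S⟩ = tr(Rᵗ S̄)`. -/
def inn (R S : Matrix X X ℂ) : ℂ := (Rᵀ * S.map (starRingEnd ℂ)).trace

/-- The dual idempotent `E_i*` with respect to the base vertex `x`. -/
def Estar (Γ : DRG X) (x : X) (i : ℕ) : Matrix X X ℂ :=
  Matrix.diagonal fun y => if Γ.G.dist x y = i then (1 : ℂ) else 0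

/-- The polynomials `v_i`. -/
def vpoly (Γ : DRG X) : ℕ → Polynomial ℝ
  | 0 => 1
  | 1 => Polynomial.X
  | n + 2 =>
      ((Γ.cI (n + 2) : ℝ))⁻¹ •
        (Polynomial.X * vpoly Γ (n + 1) - (Γ.aI (n + 1) : ℝ) • vpoly Γ (n + 1)
          - (Γ.bI n : ℝ) • vpoly Γ n)

/-- The polynomials `u_i = v_i / k_i`. -/
def upoly (Γ : DRG X) (i : ℕ) : Polynomial ℝ := ((Γ.kI i : ℝ))⁻¹ • Γ.vpoly i

end DRG

/-- A system of primitive idempotents (with eigenvalues and Krein parameters) for `Γ`. -/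
structure IdemSys {X : Type} [Fintype X] [DecidableEq X] (Γ : DRG X) where
  E : Fin (Γ.D + 1) → Matrix X X ℂ
  θ : Fin (Γ.D + 1) → ℝ
  q : Fin (Γ.D + 1) → Fin (Γ.D + 1) → Fin (Γ.D + 1) → ℝ
  hE0 : E 0 = ((Fintype.card X : ℂ))⁻¹ • Matrix.of fun _ _ => (1 : ℂ)
  hEsum : ∑ i, E i = 1
  hEmul : ∀ i j, E i * E j = if i = j then E i else 0
  hEsymm : ∀ i, (E i)ᵀ = E i
  hEreal : ∀ i, (E i).map (starRingEnd ℂ) = E i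
  hEbasis : ∀ i, E i ∈ Submodule.span ℂ (Set.range fun n : Fin (Γ.D + 1) => Γ.A (n : ℕ))
  hEig : ∀ j, Γ.A 1 * E j = (θ j : ℂ) • E j
  hθ0 : θ 0 = (Γ.kval : ℝ)
  hθinj : Function.Injective θ
  hKrein : ∀ i j, Matrix.hadamard (E i) (E j) =
    ((Fintype.card X : ℂ))⁻¹ • ∑ h, (q h i j : ℂ) • E h

namespace IdemSys

variable {X : Type} [Fintype X] [DecidableEq X] {Γ : DRG X}

/-- `m_j`, the rank of `E_j`. -/
def m (I : IdemSys Γ) (j : Fin (Γ.D + 1)) : ℕ := (I.E j).rank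

/-- The dual distance matrix `A_i*` with respect to `x` and `E_i`. -/
def Astar (I : IdemSys Γ) (x : X) (i : Fin (Γ.D + 1)) : Matrix X X ℂ :=
  Matrix.diagonal fun y => (Fintype.card X : ℂ) * I.E i x y

end IdemSys

/-- `Γ` is Q-polynomial with respect to the ordering `E_{σ 0}, ..., E_{σ D}`. -/
def QPolyOrdering {X : Type} [Fintype X] [DecidableEq X] {Γ : DRG X} (I : IdemSys Γ)
    (σ : Equiv.Perm (Fin (Γ.D + 1))) : Prop :=
  ∀ h i j : Fin (Γ.D + 1),
    (((i : ℕ) + (j : ℕ) < (h : ℕ) ∨ (h : ℕ) + (j : ℕ) < (i : ℕ) ∨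
        (h : ℕ) + (i : ℕ) < (j : ℕ)) → I.q (σ h) (σ i) (σ j) = 0) ∧
    (((h : ℕ) = (i : ℕ) + (j : ℕ) ∨ (i : ℕ) = (h : ℕ) + (j : ℕ) ∨
        (j : ℕ) = (h : ℕ) + (i : ℕ)) → I.q (σ h) (σ i) (σ j) ≠ 0)

/-- The matrix `S^alt`. -/
def salt {n : ℕ} (S : Matrix (Fin (n + 1)) (Fin (n + 1)) ℂ) : Matrix (Fin n) (Fin n) ℂ :=
  Matrix.of fun i j => S i.succ j.succ - S 0 j.succ

/-- The matrix `(S^{-1})^alt`. -/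
def altInv {n : ℕ} (T : Matrix (Fin (n + 1)) (Fin (n + 1)) ℂ) : Matrix (Fin n) (Fin n) ℂ :=
  Matrix.of fun i j => T i.succ j.succ

/-- The `4D` matrices `A_2E_i*A − AE_i*A_2, A_3E_i* − E_i*A_3, A_2E_i* − E_i*A_2, AE_i* − E_i*A`. -/
def vecE {X : Type} [Fintype X] [DecidableEq X] (Γ : DRG X) (x : X)
    (a : Fin 4) (i : Fin Γ.D) : Matrix X X ℂ :=
  ![Γ.A 2 * Γ.Estar x ((i : ℕ) + 1) * Γ.A 1 - Γ.A 1 * Γ.Estar x ((i : ℕ) + 1) * Γ.A 2,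
    Γ.A 3 * Γ.Estar x ((i : ℕ) + 1) - Γ.Estar x ((i : ℕ) + 1) * Γ.A 3,
    Γ.A 2 * Γ.Estar x ((i : ℕ) + 1) - Γ.Estar x ((i : ℕ) + 1) * Γ.A 2,
    Γ.A 1 * Γ.Estar x ((i : ℕ) + 1) - Γ.Estar x ((i : ℕ) + 1) * Γ.A 1] a

/-- The `4D` matrices `A_2A_i*A − AA_i*A_2, A_3A_i* − A_i*A_3, A_2A_i* − A_i*A_2, AA_i* − A_i*A`. -/
def vecA {X : Type} [Fintype X] [DecidableEq X] {Γ : DRG X} (I : IdemSys Γ) (x : X)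
    (a : Fin 4) (i : Fin Γ.D) : Matrix X X ℂ :=
  ![Γ.A 2 * I.Astar x i.succ * Γ.A 1 - Γ.A 1 * I.Astar x i.succ * Γ.A 2,
    Γ.A 3 * I.Astar x i.succ - I.Astar x i.succ * Γ.A 3,
    Γ.A 2 * I.Astar x i.succ - I.Astar x i.succ * Γ.A 2,
    Γ.A 1 * I.Astar x i.succ - I.Astar x i.succ * Γ.A 1] a

namespace DRG

variable {X : Type} [Fintype X] [DecidableEq X]

/-- The entries of a matrix in the Bose-Mesner algebra depend only on the distance. -/
lemma apply_eq_of_mem_span (Γ : DRG X) {M : Matrix X X ℂ}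
    (hM : M ∈ Submodule.span ℂ (Set.range fun n : Fin (Γ.D + 1) => Γ.A (n : ℕ)))
    {y z u v : X} (h : Γ.G.dist y z = Γ.G.dist u v) : M y z = M u v := by
  induction hM using Submodule.span_induction with
  | mem M hM =>
    obtain ⟨n, rfl⟩ := hM
    simp [A, h]
  | zero => rfl
  | add M N _ _ hM hN => simp [hM, hN]
  | smul a M _ hM => simp [hM]

lemma A_transpose (Γ : DRG X) (i : ℕ) : (Γ.A i)ᵀ = Γ.A i := by
  ext y z
  simp [A, SimpleGraph.dist_comm]

/-- For `N` diagonal, `A_i N A_j` is supported on pairs at distance at most `i + j`. -/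
lemma A_mul_diagonal_mul_A_apply (Γ : DRG X) (d : X → ℂ) {i j : ℕ} {y z : X}
    (h : i + j < Γ.G.dist y z) : (Γ.A i * Matrix.diagonal d * Γ.A j) y z = 0 := by
  rw [Matrix.mul_apply]
  refine Finset.sum_eq_zero fun w _ => ?_
  have ht := Γ.hconn.dist_triangle (u := y) (v := w) (w := z)
  by_cases hi : Γ.G.dist y w = i
  · have hj : Γ.G.dist w z ≠ j := by omega
    simp [A, hj]
  · simp [A, Matrix.mul_diagonal, hi]

lemma A_mul_diagonal_sub_apply (Γ : DRG X) (d : X → ℂ) (i : ℕ) (y z : X) :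
    (Γ.A i * Matrix.diagonal d - Matrix.diagonal d * Γ.A i) y z =
      if Γ.G.dist y z = i then d z - d y else 0 := by
  rw [Matrix.sub_apply, Matrix.mul_diagonal, Matrix.diagonal_mul]
  by_cases h : Γ.G.dist y z = i <;> simp [A, h]

/-- If some pair of vertices is at distance `i`, then so is some pair containing `x`. -/
lemma exists_dist_eq (Γ : DRG X) (x : X) {i : ℕ} (hi : i ≤ Γ.D) (h : Γ.A i ≠ 0) :
    ∃ z, Γ.G.dist x z = i := by
  obtain ⟨y, z, hyz⟩ : ∃ y z, Γ.G.dist y z = i := by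
    by_contra! hne
    exact h (by ext y z; simp [A, hne])
  have hy := Γ.hp 0 i i (Nat.zero_le _) hi hi y y (by simp)
  have hx := Γ.hp 0 i i (Nat.zero_le _) hi hi x x (by simp)
  have : Nonempty {w : X // Γ.G.dist y w = i ∧ Γ.G.dist y w = i} := ⟨⟨z, hyz, hyz⟩⟩
  have hpos := Nat.card_pos (α := {w : X // Γ.G.dist y w = i ∧ Γ.G.dist y w = i})
  rw [hy, ← hx] at hpos
  obtain ⟨⟨w, hw, _⟩⟩ := (Nat.card_pos_iff.1 hpos).1
  exact ⟨w, hw⟩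

lemma inn_sum_smul_left {ι : Type*} [Fintype ι] (c : ι → ℂ) (v : ι → Matrix X X ℂ)
    (S : Matrix X X ℂ) : ∑ a, c a * inn (v a) S = inn (∑ a, c a • v a) S := by
  simp [inn, Matrix.transpose_sum, Matrix.sum_mul, Matrix.trace_sum]

end DRG

namespace IdemSys

variable {X : Type} [Fintype X] [DecidableEq X] {Γ : DRG X} (I : IdemSys Γ)

lemma E_zero_ne_zero : I.E 0 ≠ 0 := by
  obtain ⟨x⟩ := Γ.hconn.nonempty
  have : Nonempty X := ⟨x⟩
  intro h
  have h2 := congrFun (congrFun h x) x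
  rw [I.hE0] at h2
  simp at h2

lemma E_mul_hadamard (h i j : Fin (Γ.D + 1)) :
    I.E h * Matrix.hadamard (I.E i) (I.E j) =
      ((Fintype.card X : ℂ)⁻¹ * (I.q h i j : ℂ)) • I.E h := by
  rw [I.hKrein, Matrix.mul_smul, Matrix.mul_sum, mul_smul]
  simp only [Matrix.mul_smul, I.hEmul, smul_ite, smul_zero, Finset.sum_ite_eq, Finset.mem_univ,
    if_true]

lemma E_ne_zero (hQ : QPolyOrdering I (Equiv.refl (Fin (Γ.D + 1)))) (j : Fin (Γ.D + 1)) :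
    I.E j ≠ 0 := by
  obtain ⟨x⟩ := Γ.hconn.nonempty
  have : Nonempty X := ⟨x⟩
  intro h
  have hq : I.q 0 j j ≠ 0 := (hQ 0 j j).2 (by simp)
  have h2 := I.E_mul_hadamard 0 j j
  rw [h, Matrix.hadamard_zero, Matrix.mul_zero] at h2
  rcases smul_eq_zero.1 h2.symm with h3 | h3
  · simp [hq] at h3
  · exact I.E_zero_ne_zero h3

lemma linearIndependent_E (hQ : QPolyOrdering I (Equiv.refl (Fin (Γ.D + 1)))) :
    LinearIndependent ℂ I.E := by
  rw [Fintype.linearIndependent_iff]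
  intro g hg j
  have h := congrArg (fun M => M * I.E j) hg
  simp only [Matrix.sum_mul, Matrix.smul_mul, I.hEmul, Matrix.zero_mul, smul_ite, smul_zero,
    Finset.sum_ite_eq', Finset.mem_univ, if_true] at h
  exact (smul_eq_zero.1 h).resolve_right (I.E_ne_zero hQ j)

lemma finrank_span_E (hQ : QPolyOrdering I (Equiv.refl (Fin (Γ.D + 1)))) :
    Module.finrank ℂ (Submodule.span ℂ (Set.range I.E)) = Γ.D + 1 := by
  simpa using finrank_span_eq_card (I.linearIndependent_E hQ)

lemma span_E_eq_span_A (hQ : QPolyOrdering I (Equiv.refl (Fin (Γ.D + 1)))) :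
    Submodule.span ℂ (Set.range I.E) =
      Submodule.span ℂ (Set.range fun n : Fin (Γ.D + 1) => Γ.A (n : ℕ)) := by
  refine Submodule.eq_of_le_of_finrank_le (Submodule.span_le.2 ?_) ?_
  · rintro _ ⟨i, rfl⟩
    exact I.hEbasis i
  · rw [I.finrank_span_E hQ]
    simpa [Set.finrank] using
      finrank_range_le_card (R := ℂ) (b := fun n : Fin (Γ.D + 1) => Γ.A (n : ℕ))

lemma linearIndependent_A (hQ : QPolyOrdering I (Equiv.refl (Fin (Γ.D + 1)))) :
    LinearIndependent ℂ fun n : Fin (Γ.D + 1) => Γ.A (n : ℕ) := by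
  rw [linearIndependent_iff_card_eq_finrank_span, Set.finrank, ← I.span_E_eq_span_A hQ,
    I.finrank_span_E hQ, Fintype.card_fin]

lemma A_mem_span_E (hQ : QPolyOrdering I (Equiv.refl (Fin (Γ.D + 1)))) {n : ℕ} (hn : n ≤ Γ.D) :
    Γ.A n ∈ Submodule.span ℂ (Set.range I.E) := by
  rw [I.span_E_eq_span_A hQ]
  exact Submodule.subset_span ⟨⟨n, by omega⟩, rfl⟩

lemma E_conj (i : Fin (Γ.D + 1)) (y z : X) : star (I.E i y z) = I.E i y z :=
  congrFun (congrFun (I.hEreal i) y) z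

lemma E_comm (i : Fin (Γ.D + 1)) (y z : X) : I.E i y z = I.E i z y :=
  congrFun (congrFun (I.hEsymm i) z) y

lemma E_conjTranspose (i : Fin (Γ.D + 1)) : (I.E i)ᴴ = I.E i := by
  ext y z
  rw [Matrix.conjTranspose_apply, I.E_conj, I.E_comm]

lemma Astar_conjTranspose (x : X) (i : Fin (Γ.D + 1)) : (I.Astar x i)ᴴ = I.Astar x i := by
  rw [Astar, Matrix.diagonal_conjTranspose]
  congr 1
  ext y
  simp only [Pi.star_apply, star_mul', I.E_conj]
  simp

open scoped ComplexOrder in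
/-- A triple product `E_i A_h* E_j` vanishes when the Krein parameter `q^h_{ij}` does. -/
lemma E_mul_Astar_mul_E_eq_zero (x : X) {h i j : Fin (Γ.D + 1)} (hq : I.q h i j = 0) :
    I.E i * I.Astar x h * I.E j = 0 := by
  rw [← Matrix.trace_mul_conjTranspose_self_eq_zero_iff]
  have hcyc : (I.E i * I.Astar x h * I.E j * (I.E i * I.Astar x h * I.E j)ᴴ).trace =
      (I.E i * I.Astar x h * I.E j * I.Astar x h).trace := by
    rw [Matrix.conjTranspose_mul, Matrix.conjTranspose_mul, I.E_conjTranspose, I.E_conjTranspose,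
      I.Astar_conjTranspose]
    calc _ = (I.E i * I.Astar x h * (I.E j * I.E j) * I.Astar x h * I.E i).trace := by
            simp only [Matrix.mul_assoc]
      _ = (I.E i * I.E i * I.Astar x h * I.E j * I.Astar x h).trace := by
            rw [Matrix.trace_mul_comm, I.hEmul j j, if_pos rfl]
            simp only [Matrix.mul_assoc]
      _ = _ := by rw [I.hEmul i i, if_pos rfl]
  have hzero : I.E h * Matrix.hadamard (I.E i) (I.E j) = 0 := by
    simp [I.E_mul_hadamard, hq]
  have hentry : (I.E h * Matrix.hadamard (I.E i) (I.E j) * I.E h) x x = 0 := by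
    simp [hzero]
  rw [hcyc]
  have hsum : (I.E i * I.Astar x h * I.E j * I.Astar x h).trace =
      (Fintype.card X : ℂ) ^ 2 * (I.E h * Matrix.hadamard (I.E i) (I.E j) * I.E h) x x := by
    simp only [Matrix.trace, Matrix.diag_apply, Astar, Matrix.mul_diagonal]
    simp only [Matrix.mul_apply (M := _ * _), Matrix.mul_apply (M := I.E h), Matrix.mul_diagonal,
      Matrix.hadamard_apply, Finset.mul_sum, Finset.sum_mul]
    refine Finset.sum_congr rfl fun y _ => Finset.sum_congr rfl fun z _ => ?_
    rw [I.E_comm h y x, I.E_comm i z y]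
    ring
  rw [hsum, hentry, mul_zero]

/-- The span of the `E_i A* E_{i+1} − E_{i+1} A* E_i`. -/
def altSpan (x : X) : Submodule ℂ (Matrix X X ℂ) :=
  Submodule.span ℂ (Set.range fun i : Fin Γ.D =>
    I.E i.castSucc * I.Astar x 1 * I.E i.succ - I.E i.succ * I.Astar x 1 * I.E i.castSucc)

lemma finrank_altSpan_le (x : X) : Module.finrank ℂ (I.altSpan x) ≤ Γ.D := by
  exact (finrank_range_le_card (R := ℂ) _).trans_eq (Fintype.card_fin _)

lemma one_val : ((1 : Fin (Γ.D + 1)) : ℕ) = 1 := by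
  have := Γ.hD
  rw [Fin.val_one', Nat.mod_eq_of_lt (by omega)]

lemma E_commutator_mem_altSpan_of_lt (hQ : QPolyOrdering I (Equiv.refl (Fin (Γ.D + 1)))) (x : X)
    {i j : Fin (Γ.D + 1)} (hij : i < j) :
    I.E i * I.Astar x 1 * I.E j - I.E j * I.Astar x 1 * I.E i ∈ I.altSpan x := by
  by_cases h : (j : ℕ) = i + 1
  · refine Submodule.subset_span ⟨⟨i, by omega⟩, ?_⟩
    have hi : (⟨i, by omega⟩ : Fin Γ.D).castSucc = i := rfl
    have hj : (⟨i, by omega⟩ : Fin Γ.D).succ = j := Fin.ext h.symm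
    simp only [hi, hj]
  · have hlt : (i : ℕ) < j := hij
    have h1 := one_val (Γ := Γ)
    have hq1 : I.q 1 i j = 0 := (hQ 1 i j).1 (by omega)
    have hq2 : I.q 1 j i = 0 := (hQ 1 j i).1 (by omega)
    rw [I.E_mul_Astar_mul_E_eq_zero x hq1, I.E_mul_Astar_mul_E_eq_zero x hq2, sub_zero]
    exact Submodule.zero_mem _

lemma E_commutator_mem_altSpan (hQ : QPolyOrdering I (Equiv.refl (Fin (Γ.D + 1)))) (x : X)
    (i j : Fin (Γ.D + 1)) :
    I.E i * I.Astar x 1 * I.E j - I.E j * I.Astar x 1 * I.E i ∈ I.altSpan x := by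
  rcases lt_trichotomy i j with h | rfl | h
  · exact I.E_commutator_mem_altSpan_of_lt hQ x h
  · simp
  · rw [← neg_sub]
    exact Submodule.neg_mem _ (I.E_commutator_mem_altSpan_of_lt hQ x h)

lemma commutator_mem_altSpan (hQ : QPolyOrdering I (Equiv.refl (Fin (Γ.D + 1)))) (x : X)
    {M N : Matrix X X ℂ} (hM : M ∈ Submodule.span ℂ (Set.range I.E))
    (hN : N ∈ Submodule.span ℂ (Set.range I.E)) :
    M * I.Astar x 1 * N - N * I.Astar x 1 * M ∈ I.altSpan x := by
  obtain ⟨a, rfl⟩ := (Submodule.mem_span_range_iff_exists_fun ℂ).1 hM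
  obtain ⟨b, rfl⟩ := (Submodule.mem_span_range_iff_exists_fun ℂ).1 hN
  have h : (∑ i, a i • I.E i) * I.Astar x 1 * (∑ j, b j • I.E j) -
      (∑ j, b j • I.E j) * I.Astar x 1 * (∑ i, a i • I.E i) =
      ∑ i, ∑ j, (a i * b j) •
        (I.E i * I.Astar x 1 * I.E j - I.E j * I.Astar x 1 * I.E i) := by
    simp only [Matrix.sum_mul, Matrix.mul_sum, Matrix.smul_mul, Matrix.mul_smul, smul_sub,
      Finset.sum_sub_distrib, Finset.smul_sum, smul_smul]
    congr 1
    · rw [Finset.sum_comm]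
      simp only [mul_comm]
  rw [h]
  exact Submodule.sum_mem _ fun i _ => Submodule.sum_mem _ fun j _ =>
    Submodule.smul_mem _ _ (I.E_commutator_mem_altSpan hQ x i j)

open scoped ComplexOrder in
/-- Two rows of `E_j` indexed by `y, z` coincide when `(E_j)_{yz} = (E_j)_{yy}`. -/
lemma E_row_eq (j : Fin (Γ.D + 1)) {y z : X} (h : I.E j y z = I.E j y y) (v : X) :
    I.E j y v = I.E j z v := by
  have hzz : I.E j z z = I.E j y y :=
    Γ.apply_eq_of_mem_span (I.hEbasis j) (by rw [SimpleGraph.dist_self, SimpleGraph.dist_self])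
  have hmul (u w : X) : ∑ v, I.E j u v * I.E j w v = I.E j u w := by
    have h := congrFun (congrFun (I.hEmul j j) u) w
    rw [if_pos rfl, Matrix.mul_apply] at h
    simpa only [I.E_comm j _ w] using h
  have hsum : (fun v => I.E j y v - I.E j z v) ⬝ᵥ star (fun v => I.E j y v - I.E j z v) = 0 := by
    simp only [dotProduct, Pi.star_apply, star_sub, I.E_conj, sub_mul, mul_sub,
      Finset.sum_sub_distrib, hmul, hzz, I.E_comm j z y, h]
    ring
  have h0 := congrFun (dotProduct_self_star_eq_zero.1 hsum) v
  exact sub_eq_zero.1 h0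

/-- In the primitive case the dual eigenvalues `θ_i*` for `i ≠ 0` differ from `θ_0*`. -/
lemma E_apply_ne (hprim : Γ.Primitive) {j : Fin (Γ.D + 1)} (hj : j ≠ 0) (hE : I.E j ≠ 0)
    {x z : X} (hxz : x ≠ z) : I.E j x z ≠ I.E j x x := by
  intro h
  have hpos : 1 ≤ Γ.G.dist x z := Γ.hconn.pos_dist_of_ne hxz
  have hconn := hprim _ hpos (Γ.hdiam_le x z)
  have hadj (u w : X) (hd : Γ.G.dist u w = Γ.G.dist x z) (v : X) : I.E j u v = I.E j w v := by
    refine I.E_row_eq j ?_ v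
    rw [Γ.apply_eq_of_mem_span (I.hEbasis j) hd, h]
    exact Γ.apply_eq_of_mem_span (I.hEbasis j) (by simp)
  have hrow (u w v : X) : I.E j u v = I.E j w v := by
    obtain ⟨p⟩ := hconn.preconnected u w
    induction p with
    | nil => rfl
    | cons hp _ ih =>
      rw [← ih]
      rcases ((SimpleGraph.fromRel_adj _ _ _).1 hp).2 with hd | hd
      · exact hadj _ _ hd v
      · exact (hadj _ _ hd v).symm
  have : Nonempty X := ⟨x⟩
  have hcard : (Fintype.card X : ℂ) ≠ 0 := Nat.cast_ne_zero.2 Fintype.card_ne_zero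
  refine hE ?_
  have hzero : I.E 0 * I.E j = 0 := by rw [I.hEmul, if_neg hj.symm]
  ext u v
  have h0 := congrFun (congrFun hzero u) v
  rw [I.hE0, Matrix.smul_mul, Matrix.smul_apply, Matrix.mul_apply,
    Finset.sum_congr rfl fun w _ => by rw [hrow w u v]] at h0
  simpa [hcard] using h0

/-- The matrices `A_2A*A − AA*A_2`, and `A_nA* − A*A_n` for `n ≥ 1`. -/
def triple (x : X) : ℕ → Matrix X X ℂ
  | 0 => Γ.A 2 * I.Astar x 1 * Γ.A 1 - Γ.A 1 * I.Astar x 1 * Γ.A 2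
  | n + 1 => Γ.A (n + 1) * I.Astar x 1 - I.Astar x 1 * Γ.A (n + 1)

lemma triple_mem_altSpan (hQ : QPolyOrdering I (Equiv.refl (Fin (Γ.D + 1)))) (x : X) {n : ℕ}
    (hn : n ≤ Γ.D) : I.triple x n ∈ I.altSpan x := by
  have hD := Γ.hD
  cases n with
  | zero =>
    exact I.commutator_mem_altSpan hQ x (I.A_mem_span_E hQ (by omega))
      (I.A_mem_span_E hQ (by omega))
  | succ n =>
    have h1 : (1 : Matrix X X ℂ) ∈ Submodule.span ℂ (Set.range I.E) := by
      rw [← I.hEsum]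
      exact Submodule.sum_mem _ fun i _ => Submodule.subset_span ⟨i, rfl⟩
    simpa [triple] using I.commutator_mem_altSpan hQ x (I.A_mem_span_E hQ hn) h1

/-- The entries of row `x` beyond distance `3` isolate a single `A_nA* − A*A_n`. -/
lemma triple_apply (x : X) {m : ℕ} (hm : 3 < m) {z : X} (hz : Γ.G.dist x z = m) (n : ℕ) :
    I.triple x n x z =
      if m = n then (Fintype.card X : ℂ) * (I.E 1 x z - I.E 1 x x) else 0 := by
  cases n with
  | zero =>
    rw [if_neg (by omega), triple, Matrix.sub_apply, Astar,
      Γ.A_mul_diagonal_mul_A_apply _ (by omega), Γ.A_mul_diagonal_mul_A_apply _ (by omega),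
      sub_zero]
  | succ n => rw [triple, Astar, Γ.A_mul_diagonal_sub_apply, hz, mul_sub]

lemma exists_triple_relation (hprim : Γ.Primitive)
    (hQ : QPolyOrdering I (Equiv.refl (Fin (Γ.D + 1)))) (x : X) :
    ∃ c : ℕ → ℂ, (∃ n < 4, c n ≠ 0) ∧ ∑ n ∈ Finset.range 4, c n • I.triple x n = 0 := by
  have hD := Γ.hD
  have hdep : ¬ LinearIndependent ℂ fun n : Fin (Γ.D + 1) => I.triple x n := by
    intro hli
    have hle : Submodule.span ℂ (Set.range fun n : Fin (Γ.D + 1) => I.triple x n) ≤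
        I.altSpan x := by
      rw [Submodule.span_le]
      rintro _ ⟨n, rfl⟩
      exact I.triple_mem_altSpan hQ x (by omega)
    have hfr := Submodule.finrank_mono hle
    rw [finrank_span_eq_card hli, Fintype.card_fin] at hfr
    have := I.finrank_altSpan_le x
    omega
  obtain ⟨g, hg, i, hi⟩ := Fintype.not_linearIndependent_iff.1 hdep
  let c : ℕ → ℂ := fun n => if h : n < Γ.D + 1 then g ⟨n, h⟩ else 0
  have hcg (n : Fin (Γ.D + 1)) : c n = g n := dif_pos n.isLt
  have hsum : ∑ n ∈ Finset.range (Γ.D + 1), c n • I.triple x n = 0 := by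
    rw [← Fin.sum_univ_eq_sum_range (fun n => c n • I.triple x n)]
    simpa only [hcg] using hg
  have h10 : (1 : Fin (Γ.D + 1)) ≠ 0 := by
    intro h
    have := congrArg Fin.val h
    rw [one_val] at this
    simp at this
  have hc (m : ℕ) (hm : 3 < m) : c m = 0 := by
    by_cases hmD : m < Γ.D + 1
    · obtain ⟨z, hz⟩ := Γ.exists_dist_eq x (i := m) (by omega)
        ((I.linearIndependent_A hQ).ne_zero ⟨m, hmD⟩)
      have hxz : x ≠ z := by
        rintro rfl
        simp at hz
        omega
      have hentry := congrFun (congrFun hsum x) z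
      simp only [Matrix.sum_apply, Matrix.smul_apply, I.triple_apply x hm hz, smul_eq_mul,
        mul_ite, mul_zero, Finset.sum_ite_eq, Finset.mem_range, hmD, if_true,
        Matrix.zero_apply] at hentry
      have : Nonempty X := ⟨x⟩
      have hcard : (Fintype.card X : ℂ) ≠ 0 := Nat.cast_ne_zero.2 Fintype.card_ne_zero
      exact (mul_eq_zero.1 hentry).resolve_right
        (mul_ne_zero hcard (sub_ne_zero.2 (I.E_apply_ne hprim h10 (I.E_ne_zero hQ 1) hxz)))
    · exact dif_neg hmD
  refine ⟨c, ⟨i, ?_, by rwa [hcg]⟩, ?_⟩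
  · by_contra hlt
    exact hi (by rw [← hcg, hc _ (by omega)])
  · rw [← hsum]
    refine Finset.sum_subset (Finset.range_subset_range.2 (by omega)) fun n _ hn => ?_
    rw [hc n (by rw [Finset.mem_range] at hn; omega), zero_smul]

lemma exists_vecA_relation (hprim : Γ.Primitive)
    (hQ : QPolyOrdering I (Equiv.refl (Fin (Γ.D + 1)))) (x : X) (i : Fin Γ.D) (hi : (i : ℕ) = 0) :
    ∃ c : Fin 4 → ℂ, c ≠ 0 ∧ ∑ a, c a • vecA I x a i = 0 := by
  obtain ⟨c, ⟨n, hn, hcn⟩, hsum⟩ := I.exists_triple_relation hprim hQ x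
  have h1 : i.succ = 1 := Fin.ext (by rw [Fin.val_succ, hi, one_val])
  refine ⟨![c 0, c 3, c 2, c 1], fun h => hcn ?_, ?_⟩
  · have h0 := congrFun h 0
    have h1 := congrFun h 1
    have h2 := congrFun h 2
    have h3 := congrFun h 3
    simp only [Matrix.cons_val, Pi.zero_apply] at h0 h1 h2 h3
    interval_cases n <;> assumption
  · rw [← hsum]
    simp only [Finset.sum_range_succ, Finset.sum_range_zero, Fin.sum_univ_four, vecA, triple, h1,
      Matrix.cons_val]
    abel

end IdemSys

/-- if `Γ` is primitive and `Q`-polynomial with respect to the ordering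
`E_0, E_1, ..., E_D`, then `AA*A_2 − A_2A*A, A*A_3 − A_3A*, A*A_2 − A_2A*, A*A − AA*`
(with `A* = A_1*`) are linearly dependent over `ℂ`; consequently `det(B_1) = 0`. -/
theorem stmt_17 {X : Type} [Fintype X] [DecidableEq X] (Γ : DRG X) (hprim : Γ.Primitive)
    (I : IdemSys Γ) (hQ : QPolyOrdering I (Equiv.refl (Fin (Γ.D + 1)))) (x : X) :
    ¬ LinearIndependent ℂ
        ![Γ.A 1 * I.Astar x 1 * Γ.A 2 - Γ.A 2 * I.Astar x 1 * Γ.A 1,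
          I.Astar x 1 * Γ.A 3 - Γ.A 3 * I.Astar x 1,
          I.Astar x 1 * Γ.A 2 - Γ.A 2 * I.Astar x 1,
          I.Astar x 1 * Γ.A 1 - Γ.A 1 * I.Astar x 1] ∧
    (Matrix.of fun a b : Fin 4 =>
        DRG.inn (vecA I x a ⟨0, by have := Γ.hD; omega⟩)
          (vecA I x b ⟨0, by have := Γ.hD; omega⟩)).det = 0 := by
  have hD := Γ.hD
  obtain ⟨c, hc, hsum⟩ := I.exists_vecA_relation hprim hQ x ⟨0, by omega⟩ rfl
  constructor
  · rw [Fintype.not_linearIndependent_iff]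
    obtain ⟨a, ha⟩ := Function.ne_iff.1 hc
    refine ⟨c, ?_, a, ha⟩
    have h1 : (⟨0, by omega⟩ : Fin Γ.D).succ = 1 := Fin.ext IdemSys.one_val.symm
    rw [← neg_eq_zero, ← hsum]
    simp only [Fin.sum_univ_four, vecA, h1, Matrix.cons_val, smul_sub]
    abel
  · refine Matrix.exists_vecMul_eq_zero_iff.1 ⟨c, hc, ?_⟩
    ext b
    simp only [Matrix.vecMul, dotProduct, Matrix.of_apply, Pi.zero_apply]
    rw [DRG.inn_sum_smul_left c (fun a => vecA I x a ⟨0, by omega⟩), hsum]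
    simp [DRG.inn]
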